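/- arXiv:math/0610895 — 2 statements merged into one kernel-verified Lean document; each statement's English description precedes it below -/
import Mathlib

section
/- Every irreducible (simple) left U-module on which both K and H act semisimply is isomorphic to one of the quotients U/P_{1,n+1} (n ≥ 0), U/P_{1,∞}, U/P_{∞,1}, or U/P_{∞,∞} for some α ∈ ℂ and β, γ ∈ ℂ*; that is, the modules constructed from the left ideals P_{1,n+1}, P_{1,∞}, P_{∞,1}, P_{∞,∞} exhaust all irreducible weight representations of U. -/
set_option synthInstance.maxHeartbeats 1000000
set_option maxHeartbeats 1000000

noncomputable section

open FreeAlgebra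

/-- Generators of the quantum group `U_q(f(K,H))`. -/
inductive Gen : Type
  | E | F | K | Kinv | H | Hinv

/-- The free algebra on the generators. -/
abbrev FA : Type := FreeAlgebra ℂ Gen

def gE : FA := ι ℂ Gen.E
def gF : FA := ι ℂ Gen.F
def gK : FA := ι ℂ Gen.K
def gKi : FA := ι ℂ Gen.Kinv
def gH : FA := ι ℂ Gen.H
def gHi : FA := ι ℂ Gen.Hinv

/-- The defining relations of `U_q(f(K,H))`, where `r` is the element of the free
algebra representing the Laurent polynomial `f(K,H)` appearing in `EF - FE = f(K,H)`. -/
inductive URel (q : ℂ) (r : FA) : FA → FA → Prop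
  | KKi : URel q r (gK * gKi) 1
  | KiK : URel q r (gKi * gK) 1
  | HHi : URel q r (gH * gHi) 1
  | HiH : URel q r (gHi * gH) 1
  | KH  : URel q r (gK * gH) (gH * gK)
  | KE  : URel q r (gK * gE) (q ^ 2 • (gE * gK))
  | KF  : URel q r (gK * gF) ((q ^ 2)⁻¹ • (gF * gK))
  | HE  : URel q r (gH * gE) ((q ^ 2)⁻¹ • (gE * gH))
  | HF  : URel q r (gH * gF) (q ^ 2 • (gF * gH))
  | EF  : URel q r (gE * gF - gF * gE) r

/-- `U_q(f(K,H))` as a quotient of the free algebra. -/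
abbrev Uq (q : ℂ) (r : FA) : Type := RingQuot (URel q r)

variable (q : ℂ) (r : FA)

def uE : Uq q r := RingQuot.mkAlgHom ℂ (URel q r) gE
def uF : Uq q r := RingQuot.mkAlgHom ℂ (URel q r) gF
def uK : Uq q r := RingQuot.mkAlgHom ℂ (URel q r) gK
def uKi : Uq q r := RingQuot.mkAlgHom ℂ (URel q r) gKi
def uH : Uq q r := RingQuot.mkAlgHom ℂ (URel q r) gH
def uHi : Uq q r := RingQuot.mkAlgHom ℂ (URel q r) gHi

/-- The element `f_m(K,H) = (K^m - H^m)/(q - q⁻¹)` of the free algebra. -/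
def fm (q : ℂ) (m : ℕ) : FA := (q - q⁻¹)⁻¹ • (gK ^ m - gH ^ m)

/-- The quantum group `U_q(f_m(K,H))`. -/
abbrev Um (q : ℂ) (m : ℕ) : Type := Uq q (fm q m)

end
/-- The left ideal `P_{1,n+1} = U(EF - α) + U(K - β) + U(H - γ) + UE + UF^{n+1}`. -/
noncomputable def P1n (q : ℂ) (m : ℕ) (α β γ : ℂ) (n : ℕ) :
    Submodule (Um q m) (Um q m) :=
  Submodule.span (Um q m)
    {uE q (fm q m) * uF q (fm q m) - algebraMap ℂ (Um q m) α,
     uK q (fm q m) - algebraMap ℂ (Um q m) β,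
     uH q (fm q m) - algebraMap ℂ (Um q m) γ,
     uE q (fm q m),
     uF q (fm q m) ^ (n + 1)}

/-- The left ideal `P_{1,∞} = U(EF - α) + U(K - β) + U(H - γ) + UE`. -/
noncomputable def P1inf (q : ℂ) (m : ℕ) (α β γ : ℂ) :
    Submodule (Um q m) (Um q m) :=
  Submodule.span (Um q m)
    {uE q (fm q m) * uF q (fm q m) - algebraMap ℂ (Um q m) α,
     uK q (fm q m) - algebraMap ℂ (Um q m) β,
     uH q (fm q m) - algebraMap ℂ (Um q m) γ,
     uE q (fm q m)}

/-- The left ideal `P_{∞,1} = U(EF - α) + U(K - β) + U(H - γ) + UF`. -/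
noncomputable def Pinf1 (q : ℂ) (m : ℕ) (α β γ : ℂ) :
    Submodule (Um q m) (Um q m) :=
  Submodule.span (Um q m)
    {uE q (fm q m) * uF q (fm q m) - algebraMap ℂ (Um q m) α,
     uK q (fm q m) - algebraMap ℂ (Um q m) β,
     uH q (fm q m) - algebraMap ℂ (Um q m) γ,
     uF q (fm q m)}

/-- The left ideal `P_{∞,∞} = U(EF - α) + U(K - β) + U(H - γ)`. -/
noncomputable def Pinfinf (q : ℂ) (m : ℕ) (α β γ : ℂ) :
    Submodule (Um q m) (Um q m) :=
  Submodule.span (Um q m)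
    {uE q (fm q m) * uF q (fm q m) - algebraMap ℂ (Um q m) α,
     uK q (fm q m) - algebraMap ℂ (Um q m) β,
     uH q (fm q m) - algebraMap ℂ (Um q m) γ}
/-- `u ∈ U` acts semisimply (diagonalizably) on the `U`-module `V`: every vector is a
sum of eigenvectors of `u` (with eigenvalues in `ℂ`). -/
def ActsDiag (q : ℂ) (m : ℕ) (V : Type*) [AddCommGroup V] [Module (Um q m) V]
    (u : Um q m) : Prop :=
  ∀ v : V, v ∈ AddSubgroup.closure
    {w : V | ∃ a : ℂ, u • w = algebraMap ℂ (Um q m) a • w}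
/-- `E, F, K, K⁻¹, H, H⁻¹` generate the algebra `A` and satisfy the relations of
`U_q(f_m(K,H))` that concern the action on weight vectors. -/
structure IsQuantumGen {A : Type*} [Ring A] [Algebra ℂ A] (q : ℂ) (m : ℕ)
    (E F K Ki H Hi : A) : Prop where
  KiK : Ki * K = 1
  HiH : Hi * H = 1
  KH : K * H = H * K
  KE : K * E = q ^ 2 • (E * K)
  KF : K * F = (q ^ 2)⁻¹ • (F * K)
  HE : H * E = (q ^ 2)⁻¹ • (E * H)
  HF : H * F = q ^ 2 • (F * H)
  EF : E * F - F * E = (q - q⁻¹)⁻¹ • (K ^ m - H ^ m)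
  adjoin : Algebra.adjoin ℂ {E, F, K, Ki, H, Hi} = ⊤

/-- The `k`-th rung of the ladder: `E ^ k` for `k ≥ 0` and `F ^ (-k)` for `k < 0`. -/
def ladder {A : Type*} [Monoid A] (E F : A) : ℤ → A
  | Int.ofNat n => E ^ n
  | Int.negSucc n => F ^ (n + 1)

/-- `v` is a weight vector of weight `(a, b)`. -/
def IsWeight {A N : Type*} [Ring A] [AddCommGroup N] [Module A N] [Module ℂ N]
    (K H : A) (a b : ℂ) (v : N) : Prop :=
  K • v = a • v ∧ H • v = b • v

/-- The subspace spanned by the images of `Y` under the rungs of the ladder. -/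
noncomputable def ladderSpan {A N : Type*} [Ring A] [Algebra ℂ A] [AddCommGroup N] [Module A N]
    [Module ℂ N] [IsScalarTower ℂ A N] (E F : A) (Y : Submodule ℂ N) : Submodule ℂ N :=
  ⨆ k : ℤ, Y.map (Algebra.lsmul ℂ ℂ N (ladder E F k))

lemma eigen_ne_zero {A : Type*} [Ring A] {N : Type*} [AddCommGroup N] [Module A N]
    [Module ℂ N] {g gi : A} {a : ℂ} (h : gi * g = 1) {v : N}
    (hv : g • v = a • v) (hv0 : v ≠ 0) : a ≠ 0 := by
  rintro rfl
  apply hv0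
  rw [← one_smul A v, ← h, mul_smul, hv, zero_smul, smul_zero]

section Abstract

variable {A : Type*} [Ring A] [Algebra ℂ A] {N : Type*} [AddCommGroup N] [Module A N]
  [Module ℂ N] [IsScalarTower ℂ A N]

lemma eigen_pow_smul {g x : A} {c a : ℂ} (h : g * x = c • (x * g)) {v : N}
    (hv : g • v = a • v) (n : ℕ) : g • x ^ n • v = (c ^ n * a) • x ^ n • v := by
  induction n with
  | zero => simpa using hv
  | succ n ih =>
    rw [pow_succ', ← mul_smul, ← mul_assoc, h, smul_mul_assoc, smul_assoc, mul_assoc, mul_smul,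
      mul_smul g, ih, smul_comm x, mul_smul x, smul_smul, pow_succ']
    ring_nf

lemma eigen_inv_smul {g gi : A} {a : ℂ} (h : gi * g = 1) {v : N} (hv : g • v = a • v) :
    gi • v = a⁻¹ • v := by
  have h1 : v = a • gi • v := by rw [smul_comm, ← hv, ← mul_smul, h, one_smul]
  rcases eq_or_ne a 0 with rfl | ha
  · rw [zero_smul] at h1
    simp [h1]
  · rw [eq_inv_smul_iff₀ ha, ← h1]

lemma eigen_pow {g : A} {a : ℂ} {v : N} (hv : g • v = a • v) (n : ℕ) :
    g ^ n • v = a ^ n • v := by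
  induction n with
  | zero => simp
  | succ n ih => rw [pow_succ, mul_smul, hv, smul_comm, ih, smul_smul, pow_succ']

lemma eigen_finsupp_sum_eq_zero {ι : Type*} (g : A) {μ : ι → ℂ} (hμ : Function.Injective μ)
    {f : ι →₀ N} (hf : ∀ i, g • f i = μ i • f i) (h : (f.sum fun _ x => x) = 0) : f = 0 := by
  have hind := ((Algebra.lsmul ℂ ℂ N g).eigenspaces_iSupIndep).comp hμ
  rw [iSupIndep_iff_finsetSum_eq_zero_imp_eq_zero] at hind
  ext i
  by_cases hi : i ∈ f.support
  · exact hind f.support f (fun j _ => Module.End.mem_eigenspace_iff.2 (hf j)) h i hi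
  · simpa using hi

lemma smul_mem_of_adjoin {s : Set A} (hs : Algebra.adjoin ℂ s = ⊤) {S : Submodule ℂ N}
    (hS : ∀ g ∈ s, ∀ z ∈ S, g • z ∈ S) (u : A) {z : N} (hz : z ∈ S) : u • z ∈ S := by
  have hu : u ∈ Algebra.adjoin ℂ s := hs ▸ Algebra.mem_top
  induction hu using Algebra.adjoin_induction generalizing z with
  | mem x hx => exact hS x hx z hz
  | algebraMap r => rw [algebraMap_smul]; exact S.smul_mem r hz
  | add x y _ _ hx hy => rw [add_smul]; exact S.add_mem (hx hz) (hy hz)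
  | mul x y _ _ hx hy => rw [mul_smul]; exact hx (hy hz)

lemma smul_mem_ladderSpan {E F : A} {Y : Submodule ℂ N} (k : ℤ) {y : N} (hy : y ∈ Y) :
    ladder E F k • y ∈ ladderSpan E F Y :=
  Submodule.mem_iSup_of_mem k ⟨y, hy, rfl⟩

lemma exists_finsupp_of_mem_ladderSpan {E F : A} {Y : Submodule ℂ N} {x : N}
    (hx : x ∈ ladderSpan E F Y) :
    ∃ f : ℤ →₀ N, (∀ k, ∃ y ∈ Y, ladder E F k • y = f k) ∧ (f.sum fun _ z => z) = x :=
  (Submodule.mem_iSup_iff_exists_finsupp _ _).1 hx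

lemma smul_mem_ladderSpan_of_forall {E F g : A} {Y : Submodule ℂ N}
    (h : ∀ k : ℤ, ∀ y ∈ Y, g • ladder E F k • y ∈ ladderSpan E F Y) {z : N}
    (hz : z ∈ ladderSpan E F Y) : g • z ∈ ladderSpan E F Y := by
  have hle : ladderSpan E F Y ≤ (ladderSpan E F Y).comap (Algebra.lsmul ℂ ℂ N g) := by
    refine iSup_le fun k => ?_
    rintro _ ⟨y, hy, rfl⟩
    exact h k y hy
  exact hle hz

lemma injective_sq_zpow_mul {q : ℂ} (hq0 : q ≠ 0) (hq : ∀ n : ℕ, 0 < n → q ^ n ≠ 1) {β : ℂ}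
    (hβ : β ≠ 0) : Function.Injective fun k : ℤ => (q ^ 2) ^ k * β := by
  have hpos : ∀ n : ℤ, 0 < n → (q ^ 2) ^ n ≠ 1 := by
    intro n hn h
    lift n to ℕ using hn.le
    rw [zpow_natCast, ← pow_mul] at h
    exact hq (2 * n) (by omega) h
  have hlt : ∀ j k : ℤ, j < k → (q ^ 2) ^ j ≠ (q ^ 2) ^ k := by
    intro j k hjk h
    apply hpos (k - j) (by omega)
    rw [zpow_sub₀ (pow_ne_zero 2 hq0), h, div_self (zpow_ne_zero _ (pow_ne_zero 2 hq0))]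
  intro j k h
  have h' : (q ^ 2) ^ j = (q ^ 2) ^ k := mul_right_cancel₀ hβ h
  rcases lt_trichotomy j k with hjk | hjk | hjk
  · exact absurd h' (hlt j k hjk)
  · exact hjk
  · exact absurd h'.symm (hlt k j hjk)

namespace IsQuantumGen

variable {q : ℂ} {m : ℕ} {E F K Ki H Hi : A}

lemma isWeight_E (D : IsQuantumGen q m E F K Ki H Hi) {a b : ℂ} {v : N}
    (hv : IsWeight K H a b v) (n : ℕ) :
    IsWeight K H ((q ^ 2) ^ n * a) (((q ^ 2)⁻¹) ^ n * b) (E ^ n • v) :=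
  ⟨eigen_pow_smul D.KE hv.1 n, eigen_pow_smul D.HE hv.2 n⟩

lemma isWeight_F (D : IsQuantumGen q m E F K Ki H Hi) {a b : ℂ} {v : N}
    (hv : IsWeight K H a b v) (n : ℕ) :
    IsWeight K H (((q ^ 2)⁻¹) ^ n * a) ((q ^ 2) ^ n * b) (F ^ n • v) :=
  ⟨eigen_pow_smul D.KF hv.1 n, eigen_pow_smul D.HF hv.2 n⟩

lemma isWeight_ladder (D : IsQuantumGen q m E F K Ki H Hi) {a b : ℂ} {v : N}
    (hv : IsWeight K H a b v) (k : ℤ) :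
    IsWeight K H ((q ^ 2) ^ k * a) (((q ^ 2)⁻¹) ^ k * b) (ladder E F k • v) := by
  cases k with
  | ofNat n => simpa [ladder] using D.isWeight_E hv n
  | negSucc n => simpa [ladder, zpow_negSucc] using D.isWeight_F hv (n + 1)

lemma isWeight_EF_pow (D : IsQuantumGen q m E F K Ki H Hi) (hq0 : q ≠ 0) {a b : ℂ} {v : N}
    (hv : IsWeight K H a b v) (n : ℕ) : IsWeight K H a b ((E * F) ^ n • v) := by
  have hK : K * (E * F) = (1 : ℂ) • ((E * F) * K) := by
    rw [← mul_assoc, D.KE, smul_mul_assoc, mul_assoc, D.KF, mul_smul_comm, smul_smul,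
      mul_inv_cancel₀ (pow_ne_zero 2 hq0), mul_assoc]
  have hH : H * (E * F) = (1 : ℂ) • ((E * F) * H) := by
    rw [← mul_assoc, D.HE, smul_mul_assoc, mul_assoc, D.HF, mul_smul_comm, smul_smul,
      inv_mul_cancel₀ (pow_ne_zero 2 hq0), mul_assoc]
  constructor
  · simpa using eigen_pow_smul hK hv.1 n
  · simpa using eigen_pow_smul hH hv.2 n

lemma isWeight_aeval (D : IsQuantumGen q m E F K Ki H Hi) (hq0 : q ≠ 0) {a b : ℂ} {v : N}
    (hv : IsWeight K H a b v) (p : Polynomial ℂ) :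
    IsWeight K H a b (Polynomial.aeval (E * F) p • v) := by
  induction p using Polynomial.induction_on' with
  | add p r hp hr =>
    simp only [map_add, add_smul]
    exact ⟨by rw [smul_add, hp.1, hr.1, smul_add], by rw [smul_add, hp.2, hr.2, smul_add]⟩
  | monomial n c =>
    have h := D.isWeight_EF_pow hq0 hv n
    rw [Polynomial.aeval_monomial, mul_smul, algebraMap_smul]
    exact ⟨by rw [smul_comm K, h.1, smul_comm c], by rw [smul_comm H, h.2, smul_comm c]⟩

lemma EF_smul (D : IsQuantumGen q m E F K Ki H Hi) {a b : ℂ} {v : N}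
    (hv : IsWeight K H a b v) :
    E • F • v = F • E • v + ((q - q⁻¹)⁻¹ * (a ^ m - b ^ m)) • v := by
  rw [← mul_smul, sub_eq_iff_eq_add'.1 D.EF, add_smul, smul_assoc, sub_smul (K ^ m) (H ^ m) v,
    eigen_pow hv.1, eigen_pow hv.2, ← sub_smul, smul_smul, mul_smul F]

lemma exists_E_smul_F_pow (D : IsQuantumGen q m E F K Ki H Hi) {a b : ℂ} {Y : Submodule ℂ N}
    (hY : ∀ y ∈ Y, IsWeight K H a b y) (hT : ∀ y ∈ Y, E • F • y ∈ Y) (n : ℕ) :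
    ∀ y ∈ Y, ∃ z ∈ Y, E • F ^ (n + 1) • y = F ^ n • z := by
  induction n with
  | zero => exact fun y hy => ⟨_, hT y hy, by simp⟩
  | succ n ih =>
    intro y hy
    obtain ⟨z, hz, hzE⟩ := ih y hy
    refine ⟨z + ((q - q⁻¹)⁻¹ * ((((q ^ 2)⁻¹) ^ (n + 1) * a) ^ m - ((q ^ 2) ^ (n + 1) * b) ^ m)) • y,
      Y.add_mem hz (Y.smul_mem _ hy), ?_⟩
    rw [pow_succ' F (n + 1), mul_smul, D.EF_smul (D.isWeight_F (hY y hy) (n + 1)), hzE,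
      ← mul_smul F, ← pow_succ', ← smul_comm, ← smul_add]

lemma exists_F_smul_E_pow (D : IsQuantumGen q m E F K Ki H Hi) {a b : ℂ} {Y : Submodule ℂ N}
    (hY : ∀ y ∈ Y, IsWeight K H a b y) (hT : ∀ y ∈ Y, E • F • y ∈ Y) (n : ℕ) :
    ∀ y ∈ Y, ∃ z ∈ Y, F • E ^ (n + 1) • y = E ^ n • z := by
  induction n with
  | zero =>
    refine fun y hy => ⟨F • E • y, ?_, by simp⟩
    rw [← sub_eq_iff_eq_add.2 (D.EF_smul (hY y hy))]
    exact Y.sub_mem (hT y hy) (Y.smul_mem _ hy)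
  | succ n ih =>
    intro y hy
    obtain ⟨z, hz, hzF⟩ := ih y hy
    refine ⟨z - ((q - q⁻¹)⁻¹ * (((q ^ 2) ^ (n + 1) * a) ^ m - (((q ^ 2)⁻¹) ^ (n + 1) * b) ^ m)) • y,
      Y.sub_mem hz (Y.smul_mem _ hy), ?_⟩
    rw [pow_succ' E (n + 1), mul_smul,
      ← sub_eq_iff_eq_add.2 (D.EF_smul (D.isWeight_E (hY y hy) (n + 1))), hzF,
      ← mul_smul E, ← pow_succ', ← smul_comm, ← smul_sub]

lemma smul_mem_ladderSpan (D : IsQuantumGen q m E F K Ki H Hi) {a b : ℂ} {Y : Submodule ℂ N}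
    (hY : ∀ y ∈ Y, IsWeight K H a b y) (hT : ∀ y ∈ Y, E • F • y ∈ Y) (u : A) {z : N}
    (hz : z ∈ ladderSpan E F Y) : u • z ∈ ladderSpan E F Y := by
  refine smul_mem_of_adjoin D.adjoin (fun g hg z hz => ?_) u hz
  refine smul_mem_ladderSpan_of_forall (fun k y hy => ?_) hz
  have hk := _root_.smul_mem_ladderSpan (E := E) (F := F) k hy
  have hw := D.isWeight_ladder (hY y hy) k
  rcases hg with rfl | rfl | rfl | rfl | rfl | rfl
  · cases k with
    | ofNat n =>
      convert _root_.smul_mem_ladderSpan (E := g) (F := F) (Int.ofNat (n + 1)) hy using 1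
      rw [← mul_smul]
      exact congrArg (· • y) (pow_succ' g n).symm
    | negSucc n =>
      obtain ⟨z, hz, h⟩ := D.exists_E_smul_F_pow hY hT n y hy
      rw [show ladder g F (Int.negSucc n) = F ^ (n + 1) from rfl, h]
      cases n with
      | zero => simpa [ladder] using _root_.smul_mem_ladderSpan (E := g) (F := F) 0 hz
      | succ n => exact _root_.smul_mem_ladderSpan (E := g) (F := F) (Int.negSucc n) hz
  · cases k with
    | ofNat n =>
      cases n with
      | zero =>
        simpa [ladder] using _root_.smul_mem_ladderSpan (E := E) (F := g) (Int.negSucc 0) hy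
      | succ n =>
        obtain ⟨z, hz, h⟩ := D.exists_F_smul_E_pow hY hT n y hy
        rw [show ladder E g (Int.ofNat (n + 1)) = E ^ (n + 1) from rfl, h]
        exact _root_.smul_mem_ladderSpan (E := E) (F := g) (Int.ofNat n) hz
    | negSucc n =>
      convert _root_.smul_mem_ladderSpan (E := E) (F := g) (Int.negSucc (n + 1)) hy using 1
      rw [← mul_smul]
      exact congrArg (· • y) (pow_succ' g (n + 1)).symm
  · rw [hw.1]
    exact Submodule.smul_mem _ _ hk
  · rw [eigen_inv_smul D.KiK hw.1]
    exact Submodule.smul_mem _ _ hk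
  · rw [hw.2]
    exact Submodule.smul_mem _ _ hk
  · rw [eigen_inv_smul D.HiH hw.2]
    exact Submodule.smul_mem _ _ hk

lemma exists_EF_eigen_of_aeval (D : IsQuantumGen q m E F K Ki H Hi) (hq0 : q ≠ 0) {a b : ℂ}
    {v : N} (hv : IsWeight K H a b v) (hv0 : v ≠ 0) (p : Polynomial ℂ) (hp0 : p ≠ 0)
    (hp : Polynomial.aeval (E * F) p • v = 0) :
    ∃ (α : ℂ) (w : N), w ≠ 0 ∧ IsWeight K H a b w ∧ (E * F) • w = α • w := by
  induction hn : p.natDegree using Nat.strong_induction_on generalizing p with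
  | _ n ih =>
    rcases eq_or_ne p.degree 0 with hdeg | hdeg
    · rw [Polynomial.eq_C_of_degree_eq_zero hdeg] at hp hp0
      rw [Polynomial.aeval_C, algebraMap_smul] at hp
      exact absurd ((smul_eq_zero.1 hp).resolve_left fun h => hp0 (by rw [h, map_zero])) hv0
    · obtain ⟨μ, hμ⟩ := IsAlgClosed.exists_root p hdeg
      obtain ⟨r, rfl⟩ := Polynomial.dvd_iff_isRoot.2 hμ
      have hr0 : r ≠ 0 := right_ne_zero_of_mul hp0
      by_cases hr : Polynomial.aeval (E * F) r • v = 0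
      · refine ih r.natDegree ?_ r hr0 hr rfl
        rw [← hn, Polynomial.natDegree_mul (Polynomial.X_sub_C_ne_zero μ) hr0,
          Polynomial.natDegree_X_sub_C]
        omega
      · refine ⟨μ, _, hr, D.isWeight_aeval hq0 hv r, ?_⟩
        rw [map_mul, mul_smul, map_sub, Polynomial.aeval_X, Polynomial.aeval_C, sub_smul,
          algebraMap_smul, sub_eq_zero] at hp
        exact hp

/-- In a weight space of a simple module, `EF` has an eigenvector. -/
lemma exists_EF_eigen [IsSimpleModule A N] (D : IsQuantumGen q m E F K Ki H Hi) (hq0 : q ≠ 0)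
    (hq : ∀ n : ℕ, 0 < n → q ^ n ≠ 1) {a b : ℂ} {v : N} (hv : IsWeight K H a b v) (hv0 : v ≠ 0) :
    ∃ (α : ℂ) (w : N), w ≠ 0 ∧ IsWeight K H a b w ∧ (E * F) • w = α • w := by
  by_cases hTv : (E * F) • v = 0
  · exact ⟨0, v, hv0, hv, by rw [hTv, zero_smul]⟩
  let Y : Submodule ℂ N := LinearMap.range
    ((LinearMap.toSpanSingleton A N ((E * F) • v)).restrictScalars ℂ ∘ₗ
      (Polynomial.aeval (R := ℂ) (E * F)).toLinearMap)
  have hwT : IsWeight K H a b ((E * F) • v) := by simpa using D.isWeight_EF_pow hq0 hv 1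
  have hY : ∀ y ∈ Y, IsWeight K H a b y := by
    rintro _ ⟨p, rfl⟩
    exact D.isWeight_aeval hq0 hwT p
  have hT : ∀ y ∈ Y, E • F • y ∈ Y := by
    rintro _ ⟨p, rfl⟩
    refine ⟨Polynomial.X * p, ?_⟩
    simp [mul_smul]
  have hTY : (E * F) • v ∈ ladderSpan E F Y := by
    have h : (E * F) • v ∈ Y := ⟨1, by simp⟩
    simpa [ladder] using _root_.smul_mem_ladderSpan (E := E) (F := F) 0 h
  obtain ⟨u, hu⟩ := IsSimpleModule.toSpanSingleton_surjective A hTv v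
  have hvS : v ∈ ladderSpan E F Y := by
    rw [← hu]
    exact D.smul_mem_ladderSpan hY hT u hTY
  obtain ⟨f, hf, hfv⟩ := exists_finsupp_of_mem_ladderSpan hvS
  have hvf : f - Finsupp.single 0 v = 0 := by
    refine eigen_finsupp_sum_eq_zero K
      (injective_sq_zpow_mul hq0 hq (eigen_ne_zero D.KiK hv.1 hv0)) (fun k => ?_) ?_
    · obtain ⟨y, hy, hyk⟩ := hf k
      have h1 : K • f k = ((q ^ 2) ^ k * a) • f k := hyk ▸ (D.isWeight_ladder (hY y hy) k).1
      rcases eq_or_ne k 0 with rfl | hk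
      · simp only [Finsupp.sub_apply, Finsupp.single_eq_same, smul_sub, h1, hv.1, zpow_zero,
          one_mul]
      · simpa [Finsupp.single_apply, hk.symm] using h1
    · rw [Finsupp.sum_sub_index (fun _ _ _ => rfl), hfv, Finsupp.sum_single_index rfl, sub_self]
  obtain ⟨y, ⟨p, rfl⟩, hy⟩ := hf 0
  have hv' : Polynomial.aeval (E * F) p • (E * F) • v = v := by
    have h0 := DFunLike.congr_fun (sub_eq_zero.1 hvf) 0
    rw [← hy, Finsupp.single_eq_same] at h0
    simpa [ladder] using h0
  refine D.exists_EF_eigen_of_aeval hq0 hv hv0 (p * Polynomial.X - 1) (fun h => ?_) ?_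
  · simpa using congrArg (Polynomial.eval 0) h
  · rw [map_sub, map_mul, Polynomial.aeval_X, map_one, sub_smul, mul_smul, hv', one_smul, sub_self]

/-- A simple module with an `EF`-eigenvector `w` of weight `(β, γ)` is the quotient by a left
ideal `P` of annihilators of `w` as soon as each rung either lies in `P` or does not kill `w`. -/
theorem nonempty_equiv_quotient [IsSimpleModule A N] (D : IsQuantumGen q m E F K Ki H Hi)
    (hq0 : q ≠ 0) (hq : ∀ n : ℕ, 0 < n → q ^ n ≠ 1) {α β γ : ℂ} {w : N}
    (hw : IsWeight K H β γ w) (hw0 : w ≠ 0) {P : Submodule A A}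
    (hPEF : E * F - algebraMap ℂ A α ∈ P) (hPK : K - algebraMap ℂ A β ∈ P)
    (hPH : H - algebraMap ℂ A γ ∈ P) (hP : ∀ u ∈ P, u • w = 0)
    (hlad : ∀ k, ladder E F k ∈ P ∨ ladder E F k • w ≠ 0) : Nonempty (N ≃ₗ[A] A ⧸ P) := by
  let π : (A ⧸ P) →ₗ[A] N := P.liftQ (LinearMap.toSpanSingleton A N w) hP
  let x : A ⧸ P := P.mkQ 1
  have hx : ∀ u : A, u • x = P.mkQ u := fun u => by
    rw [← map_smul, smul_eq_mul, mul_one]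
  have hπ : ∀ u, π (P.mkQ u) = u • w := fun u => rfl
  have hπx : π x = w := (hπ 1).trans (one_smul A w)
  have heig : ∀ (g : A) (c : ℂ), g - algebraMap ℂ A c ∈ P → g • x = c • x := by
    intro g c h
    rw [← algebraMap_smul A c x, hx, hx, ← sub_eq_zero, ← map_sub]
    exact (Submodule.Quotient.mk_eq_zero P).2 h
  let Y : Submodule ℂ (A ⧸ P) := ℂ ∙ x
  have hY : ∀ y ∈ Y, IsWeight K H β γ y := by
    intro y hy
    obtain ⟨c, rfl⟩ := Submodule.mem_span_singleton.1 hy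
    exact ⟨by rw [smul_comm K, heig K β hPK, smul_comm c],
      by rw [smul_comm H, heig H γ hPH, smul_comm c]⟩
  have hT : ∀ y ∈ Y, E • F • y ∈ Y := by
    intro y hy
    obtain ⟨c, rfl⟩ := Submodule.mem_span_singleton.1 hy
    rw [← mul_smul, smul_comm, heig _ α hPEF]
    exact Y.smul_mem _ (Y.smul_mem _ (Submodule.mem_span_singleton_self x))
  have htop : ∀ z, z ∈ ladderSpan E F Y := by
    intro z
    obtain ⟨u, rfl⟩ := P.mkQ_surjective z
    rw [← hx]
    refine D.smul_mem_ladderSpan hY hT u ?_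
    simpa [ladder] using
      _root_.smul_mem_ladderSpan (E := E) (F := F) 0 (Submodule.mem_span_singleton_self (R := ℂ) x)
  have hπs : ∀ (c : ℂ) (z : A ⧸ P), π (c • z) = c • π z := fun c z => by
    rw [← algebraMap_smul A c z, map_smul, algebraMap_smul]
  have hinj : Function.Injective π := by
    rw [injective_iff_map_eq_zero]
    intro z hz
    obtain ⟨f, hf, rfl⟩ := exists_finsupp_of_mem_ladderSpan (htop z)
    have hmap : f.mapRange π (map_zero π) = 0 := by
      refine eigen_finsupp_sum_eq_zero K
        (injective_sq_zpow_mul hq0 hq (eigen_ne_zero D.KiK hw.1 hw0)) (fun k => ?_) ?_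
      · obtain ⟨y, hy, hyk⟩ := hf k
        rw [Finsupp.mapRange_apply, ← hyk, ← map_smul, (D.isWeight_ladder (hY y hy) k).1, hπs]
      · rw [Finsupp.sum_mapRange_index (fun _ => rfl), ← hz, map_finsuppSum]
    have hf0 : f = 0 := by
      ext k
      obtain ⟨y, hy, hyk⟩ := hf k
      obtain ⟨c, rfl⟩ := Submodule.mem_span_singleton.1 hy
      have hk := DFunLike.congr_fun hmap k
      rw [Finsupp.mapRange_apply, ← hyk, smul_comm, hπs, map_smul, hπx, Finsupp.zero_apply] at hk
      rw [Finsupp.zero_apply, ← hyk, smul_comm]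
      rcases hlad k with hmem | hne
      · rw [hx, Submodule.mkQ_apply, (Submodule.Quotient.mk_eq_zero P).2 hmem, smul_zero]
      · rw [(smul_eq_zero.1 hk).resolve_right hne, zero_smul]
    rw [hf0, Finsupp.sum_zero_index]
  have hsurj : Function.Surjective π := by
    intro v
    obtain ⟨u, hu⟩ := IsSimpleModule.toSpanSingleton_surjective A hw0 v
    exact ⟨P.mkQ u, (hπ u).trans hu⟩
  exact ⟨(LinearEquiv.ofBijective π ⟨hinj, hsurj⟩).symm⟩

/-- A nonzero module on which `K` and `H` act diagonalizably has a weight vector. -/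
lemma exists_isWeight [Nontrivial N] (D : IsQuantumGen q m E F K Ki H Hi)
    (hK : ⨆ a, (Algebra.lsmul ℂ ℂ N K).eigenspace a = ⊤)
    (hH : ⨆ b, (Algebra.lsmul ℂ ℂ N H).eigenspace b = ⊤) :
    ∃ (a b : ℂ) (v : N), v ≠ 0 ∧ IsWeight K H a b v := by
  have hex : ∃ a, (Algebra.lsmul ℂ ℂ N K).eigenspace a ≠ ⊥ := by
    by_contra! h
    simp [h] at hK
  obtain ⟨a, ha⟩ := hex
  obtain ⟨w, hw, hw0⟩ := Submodule.exists_mem_ne_zero_of_ne_bot ha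
  have hwH : w ∈ ⨆ b, (Algebra.lsmul ℂ ℂ N H).eigenspace b := hH ▸ Submodule.mem_top
  obtain ⟨f, hf, hfw⟩ := (Submodule.mem_iSup_iff_exists_finsupp _ _).1 hwH
  have hfH : ∀ b, H • f b = b • f b := fun b => Module.End.mem_eigenspace_iff.1 (hf b)
  let φ : N →ₗ[ℂ] N := Algebra.lsmul ℂ ℂ N K - a • LinearMap.id
  have hφ : ∀ z, φ z = K • z - a • z := fun z => rfl
  have h0 : f.mapRange φ (map_zero φ) = 0 := by
    refine eigen_finsupp_sum_eq_zero H Function.injective_id (fun b => ?_) ?_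
    · rw [Finsupp.mapRange_apply, hφ, smul_sub, ← mul_smul, ← D.KH, mul_smul, smul_comm H a, hfH,
        smul_comm K, smul_comm a, ← smul_sub]
      rfl
    · rw [Finsupp.sum_mapRange_index (fun _ => rfl)]
      have h1 : φ (f.sum fun _ z => z) = 0 := by
        rw [hfw, hφ, sub_eq_zero]
        exact Module.End.mem_eigenspace_iff.1 hw
      rwa [map_finsuppSum] at h1
  have hfne : f ≠ 0 := by
    rintro rfl
    exact hw0 (by rw [← hfw, Finsupp.sum_zero_index])
  obtain ⟨b, hb⟩ := Finsupp.ne_iff.1 hfne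
  refine ⟨a, b, f b, hb, ?_, hfH b⟩
  have := DFunLike.congr_fun h0 b
  rwa [Finsupp.mapRange_apply, hφ, Finsupp.zero_apply, sub_eq_zero] at this

end IsQuantumGen

end Abstract

theorem isQuantumGen_Um (q : ℂ) (m : ℕ) :
    IsQuantumGen q m (uE q (fm q m)) (uF q (fm q m)) (uK q (fm q m)) (uKi q (fm q m))
      (uH q (fm q m)) (uHi q (fm q m)) where
  KiK := by simpa [uK, uKi] using RingQuot.mkAlgHom_rel ℂ (URel.KiK (q := q) (r := fm q m))
  HiH := by simpa [uH, uHi] using RingQuot.mkAlgHom_rel ℂ (URel.HiH (q := q) (r := fm q m))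
  KH := by simpa [uK, uH] using RingQuot.mkAlgHom_rel ℂ (URel.KH (q := q) (r := fm q m))
  KE := by simpa [uK, uE] using RingQuot.mkAlgHom_rel ℂ (URel.KE (q := q) (r := fm q m))
  KF := by simpa [uK, uF] using RingQuot.mkAlgHom_rel ℂ (URel.KF (q := q) (r := fm q m))
  HE := by simpa [uH, uE] using RingQuot.mkAlgHom_rel ℂ (URel.HE (q := q) (r := fm q m))
  HF := by simpa [uH, uF] using RingQuot.mkAlgHom_rel ℂ (URel.HF (q := q) (r := fm q m))
  EF := by
    have h := RingQuot.mkAlgHom_rel ℂ (URel.EF (q := q) (r := fm q m))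
    rw [map_sub, map_mul, map_mul] at h
    have hfm : ∀ φ : FA →ₐ[ℂ] Um q m,
        φ (fm q m) = (q - q⁻¹)⁻¹ • (φ gK ^ m - φ gH ^ m) := fun φ => by simp [fm]
    exact h.trans (hfm _)
  adjoin := by
    have h := congrArg (Subalgebra.map (RingQuot.mkAlgHom ℂ (URel q (fm q m))))
      (FreeAlgebra.adjoin_range_ι ℂ Gen)
    rw [AlgHom.map_adjoin, Algebra.map_top,
      (AlgHom.range_eq_top _).2 (RingQuot.mkAlgHom_surjective ℂ _)] at h
    rw [eq_top_iff, ← h]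
    refine Algebra.adjoin_mono ?_
    rintro _ ⟨_, ⟨g, rfl⟩, rfl⟩
    cases g <;> simp [uE, uF, uK, uKi, uH, uHi, gE, gF, gK, gKi, gH, gHi]

lemma ActsDiag.iSup_eigenspace {q : ℂ} {m : ℕ} {V : Type*} [AddCommGroup V] [Module (Um q m) V]
    [Module ℂ V] [IsScalarTower ℂ (Um q m) V] {u : Um q m} (h : ActsDiag q m V u) :
    ⨆ a, (Algebra.lsmul ℂ ℂ V u).eigenspace a = ⊤ := by
  rw [eq_top_iff]
  intro v _
  refine (AddSubgroup.closure_le (⨆ a, (Algebra.lsmul ℂ ℂ V u).eigenspace a).toAddSubgroup).2 ?_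
    (h v)
  rintro w ⟨a, ha⟩
  refine Submodule.mem_iSup_of_mem a (Module.End.mem_eigenspace_iff.2 ?_)
  rw [algebraMap_smul] at ha
  exact ha

/-- Every irreducible weight `U`-module (a simple module on which both
`K` and `H` act semisimply) is isomorphic to `U/P_{1,n+1}` (some `n ≥ 0`), `U/P_{1,∞}`,
`U/P_{∞,1}`, or `U/P_{∞,∞}` for some `α ∈ ℂ`, `β, γ ∈ ℂ*`. -/
theorem stmt6 (q : ℂ) (hq0 : q ≠ 0) (hq : ∀ n : ℕ, 0 < n → q ^ n ≠ 1)
    (m : ℕ) (hm : 1 ≤ m)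
    (V : Type*) [AddCommGroup V] [Module (Um q m) V]
    (hsimple : IsSimpleModule (Um q m) V)
    (hK : ActsDiag q m V (uK q (fm q m)))
    (hH : ActsDiag q m V (uH q (fm q m))) :
    ∃ (α β γ : ℂ), β ≠ 0 ∧ γ ≠ 0 ∧
      ((∃ n : ℕ, Nonempty (V ≃ₗ[Um q m] (Um q m ⧸ P1n q m α β γ n))) ∨
       Nonempty (V ≃ₗ[Um q m] (Um q m ⧸ P1inf q m α β γ)) ∨
       Nonempty (V ≃ₗ[Um q m] (Um q m ⧸ Pinf1 q m α β γ)) ∨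
       Nonempty (V ≃ₗ[Um q m] (Um q m ⧸ Pinfinf q m α β γ))) := by
  let _ : Module ℂ V := Module.compHom V (algebraMap ℂ (Um q m))
  have : IsScalarTower ℂ (Um q m) V := ⟨fun a u v => by
    rw [Algebra.smul_def, mul_smul]
    rfl⟩
  have D := isQuantumGen_Um q m
  have : Nontrivial V := IsSimpleModule.nontrivial (Um q m) V
  set E := uE q (fm q m) with hE
  set F := uF q (fm q m) with hF
  set K := uK q (fm q m) with hKdef
  set H := uH q (fm q m) with hHdef
  have hspan : ∀ (s : Set (Um q m)) (w : V), (∀ u ∈ s, u • w = 0) →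
      ∀ u ∈ Submodule.span (Um q m) s, u • w = 0 := fun s w hs u hu =>
    Submodule.span_le (p := LinearMap.ker (LinearMap.toSpanSingleton (Um q m) V w)).2 hs hu
  have hpow : ∀ (P : Submodule (Um q m) (Um q m)) (x : Um q m) (i j : ℕ), x ^ i ∈ P → i ≤ j →
      x ^ j ∈ P := by
    intro P x i j h hij
    obtain ⟨d, rfl⟩ := Nat.exists_eq_add_of_le' hij
    rw [pow_add]
    exact P.smul_mem _ h
  have hsub : ∀ (g : Um q m) (c : ℂ) (w : V), g • w = c • w →
      (g - algebraMap ℂ (Um q m) c) • w = 0 := fun g c w h => by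
    rw [sub_smul, algebraMap_smul, h, sub_self]
  have hne : ∀ {a b : ℂ} {w : V}, IsWeight K H a b w → w ≠ 0 → a ≠ 0 ∧ b ≠ 0 := fun hw hw0 =>
    ⟨eigen_ne_zero D.KiK hw.1 hw0, eigen_ne_zero D.HiH hw.2 hw0⟩
  obtain ⟨a, b, v, hv0, hv⟩ := D.exists_isWeight hK.iSup_eigenspace hH.iSup_eigenspace
  by_cases hhigh : ∃ (a b : ℂ) (w : V), w ≠ 0 ∧ IsWeight K H a b w ∧ E • w = 0
  · obtain ⟨β, γ, w, hw0, hw, hEw⟩ := hhigh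
    obtain ⟨α, hα⟩ : ∃ α : ℂ, (E * F) • w = α • w :=
      ⟨_, by rw [mul_smul, D.EF_smul hw, hEw, smul_zero, zero_add]⟩
    refine ⟨α, β, γ, (hne hw hw0).1, (hne hw hw0).2, ?_⟩
    by_cases hlow : ∃ n : ℕ, F ^ n • w = 0
    · left
      classical
      obtain ⟨n, hn⟩ : ∃ n, Nat.find hlow = n + 1 := by
        refine Nat.exists_eq_succ_of_ne_zero fun h => hw0 ?_
        simpa [h] using Nat.find_spec hlow
      have hFn : F ^ (n + 1) • w = 0 := hn ▸ Nat.find_spec hlow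
      refine ⟨n, D.nonempty_equiv_quotient (α := α) hq0 hq hw hw0
        (Submodule.subset_span (Set.mem_insert _ _)) (Submodule.subset_span (by simp [hKdef]))
        (Submodule.subset_span (by simp [hHdef])) (hspan _ w ?_) ?_⟩
      · rintro u (rfl | rfl | rfl | rfl | rfl)
        exacts [hsub _ _ _ hα, hsub _ _ _ hw.1, hsub _ _ _ hw.2, hEw, hFn]
      · rintro ((_ | k) | k)
        · right
          simpa [ladder] using hw0
        · left
          refine hpow _ E 1 (k + 1) (Submodule.subset_span ?_) (by omega)
          simp [hE]
        · rcases Nat.lt_or_ge k n with hk | hk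
          · exact Or.inr (Nat.find_min hlow (by omega))
          · left
            refine hpow _ F (n + 1) (k + 1) (Submodule.subset_span ?_) (by omega)
            simp [hF]
    · right; left
      push Not at hlow
      refine D.nonempty_equiv_quotient (α := α) hq0 hq hw hw0
        (Submodule.subset_span (Set.mem_insert _ _)) (Submodule.subset_span (by simp [hKdef]))
        (Submodule.subset_span (by simp [hHdef])) (hspan _ w ?_) ?_
      · rintro u (rfl | rfl | rfl | rfl)
        exacts [hsub _ _ _ hα, hsub _ _ _ hw.1, hsub _ _ _ hw.2, hEw]
      · rintro ((_ | k) | k)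
        · right
          simpa [ladder] using hw0
        · left
          refine hpow _ E 1 (k + 1) (Submodule.subset_span ?_) (by omega)
          simp [hE]
        · exact Or.inr (hlow (k + 1))
  have hEpow : ∀ {a b : ℂ} {w : V}, IsWeight K H a b w → w ≠ 0 → ∀ n : ℕ, E ^ n • w ≠ 0 := by
    intro a b w hw hw0 n
    induction n with
    | zero => simpa using hw0
    | succ n ih =>
      intro h
      rw [pow_succ', mul_smul] at h
      exact hhigh ⟨_, _, _, ih, D.isWeight_E hw n, h⟩
  by_cases hlow : ∃ (a b : ℂ) (w : V), w ≠ 0 ∧ IsWeight K H a b w ∧ F • w = 0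
  · obtain ⟨β, γ, w, hw0, hw, hFw⟩ := hlow
    refine ⟨0, β, γ, (hne hw hw0).1, (hne hw hw0).2, Or.inr (Or.inr (Or.inl ?_))⟩
    refine D.nonempty_equiv_quotient (α := 0) hq0 hq hw hw0
      (Submodule.subset_span (Set.mem_insert _ _)) (Submodule.subset_span (by simp [hKdef]))
      (Submodule.subset_span (by simp [hHdef])) (hspan _ w ?_) ?_
    · rintro u (rfl | rfl | rfl | rfl)
      exacts [hsub _ _ _ (by rw [mul_smul, hFw, smul_zero, zero_smul]), hsub _ _ _ hw.1,
        hsub _ _ _ hw.2, hFw]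
    · rintro (k | k)
      · exact Or.inr (hEpow hw hw0 k)
      · left
        refine hpow _ F 1 (k + 1) (Submodule.subset_span ?_) (by omega)
        simp [hF]
  · obtain ⟨α, w, hw0, hw, hα⟩ := D.exists_EF_eigen hq0 hq hv hv0
    have hFpow : ∀ n : ℕ, F ^ n • w ≠ 0 := by
      intro n
      induction n with
      | zero => simpa using hw0
      | succ n ih =>
        intro h
        rw [pow_succ', mul_smul] at h
        exact hlow ⟨_, _, _, ih, D.isWeight_F hw n, h⟩
    refine ⟨α, a, b, (hne hw hw0).1, (hne hw hw0).2, Or.inr (Or.inr (Or.inr ?_))⟩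
    refine D.nonempty_equiv_quotient (α := α) hq0 hq hw hw0
      (Submodule.subset_span (Set.mem_insert _ _)) (Submodule.subset_span (by simp [hKdef]))
      (Submodule.subset_span (by simp [hHdef])) (hspan _ w ?_) ?_
    · rintro u (rfl | rfl | rfl)
      exacts [hsub _ _ _ hα, hsub _ _ _ hw.1, hsub _ _ _ hw.2]
    · rintro (k | k)
      · exact Or.inr (hEpow hw hw0 k)
      · exact Or.inr (hFpow (k + 1))
end

section
/- The assignment E ↦ E, F ↦ F, K ↦ K, K⁻¹ ↦ K⁻¹, H ↦ K⁻¹, H⁻¹ ↦ K extends to a unique surjective ℂ-algebra homomorphism π : U_q(f_m(K,H)) → U_q(f_m(K)), and the kernel of π is the two-sided ideal of U_q(f_m(K,H)) generated by KH − 1. -/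
set_option synthInstance.maxHeartbeats 1000000
set_option maxHeartbeats 1000000

noncomputable section
open FreeAlgebra
/-- Generators of the quantum group `U_q(f_m(K))`. -/
inductive Gen2 : Type
  | E | F | K | Kinv

/-- The free algebra on the generators of `U_q(f_m(K))`. -/
abbrev FA2 : Type := FreeAlgebra ℂ Gen2

def g2E : FA2 := ι ℂ Gen2.E
def g2F : FA2 := ι ℂ Gen2.F
def g2K : FA2 := ι ℂ Gen2.K
def g2Ki : FA2 := ι ℂ Gen2.Kinv

/-- The defining relations of `U_q(f_m(K))`, with
`EF - FE = (K^m - K^{-m})/(q - q⁻¹)`. -/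
inductive URel2 (q : ℂ) (m : ℕ) : FA2 → FA2 → Prop
  | KKi : URel2 q m (g2K * g2Ki) 1
  | KiK : URel2 q m (g2Ki * g2K) 1
  | KE  : URel2 q m (g2K * g2E) (q ^ 2 • (g2E * g2K))
  | KF  : URel2 q m (g2K * g2F) ((q ^ 2)⁻¹ • (g2F * g2K))
  | EF  : URel2 q m (g2E * g2F - g2F * g2E) ((q - q⁻¹)⁻¹ • (g2K ^ m - g2Ki ^ m))

/-- The quantum group `U_q(f_m(K))`. -/
abbrev U2 (q : ℂ) (m : ℕ) : Type := RingQuot (URel2 q m)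

def u2E (q : ℂ) (m : ℕ) : U2 q m := RingQuot.mkAlgHom ℂ (URel2 q m) g2E
def u2F (q : ℂ) (m : ℕ) : U2 q m := RingQuot.mkAlgHom ℂ (URel2 q m) g2F
def u2K (q : ℂ) (m : ℕ) : U2 q m := RingQuot.mkAlgHom ℂ (URel2 q m) g2K
def u2Ki (q : ℂ) (m : ℕ) : U2 q m := RingQuot.mkAlgHom ℂ (URel2 q m) g2Ki
end
/-- Two algebra homomorphisms out of `U_q(f(K,H))` agreeing on the generators are equal. -/
theorem Uq.algHom_ext {A : Type*} [Semiring A] [Algebra ℂ A] {q : ℂ} {r : FA}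
    {f g : Uq q r →ₐ[ℂ] A}
    (hE : f (uE q r) = g (uE q r)) (hF : f (uF q r) = g (uF q r))
    (hK : f (uK q r) = g (uK q r)) (hKi : f (uKi q r) = g (uKi q r))
    (hH : f (uH q r) = g (uH q r)) (hHi : f (uHi q r) = g (uHi q r)) : f = g := by
  refine RingQuot.ringQuot_ext' ℂ f g (FreeAlgebra.hom_ext (funext fun x => ?_))
  cases x
  exacts [hE, hF, hK, hKi, hH, hHi]

/-- The universal property of `U_q(f_m(K,H))`. -/
theorem Um.exists_lift {A : Type*} [Ring A] [Algebra ℂ A] {q : ℂ} {m : ℕ}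
    {E F K Ki H Hi : A} (hKKi : K * Ki = 1) (hKiK : Ki * K = 1) (hHHi : H * Hi = 1)
    (hHiH : Hi * H = 1) (hKH : K * H = H * K)
    (hKE : K * E = q ^ 2 • (E * K)) (hKF : K * F = (q ^ 2)⁻¹ • (F * K))
    (hHE : H * E = (q ^ 2)⁻¹ • (E * H)) (hHF : H * F = q ^ 2 • (F * H))
    (hEF : E * F - F * E = (q - q⁻¹)⁻¹ • (K ^ m - H ^ m)) :
    ∃ f : Um q m →ₐ[ℂ] A,
      f (uE q (fm q m)) = E ∧ f (uF q (fm q m)) = F ∧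
      f (uK q (fm q m)) = K ∧ f (uKi q (fm q m)) = Ki ∧
      f (uH q (fm q m)) = H ∧ f (uHi q (fm q m)) = Hi := by
  let v : Gen → A := fun x => Gen.casesOn x E F K Ki H Hi
  have w : ∀ ⦃x y⦄, URel q (fm q m) x y → FreeAlgebra.lift ℂ v x = FreeAlgebra.lift ℂ v y := by
    intro x y h
    cases h <;>
      simp only [gE, gF, gK, gKi, gH, gHi, fm, map_mul, map_sub, map_smul, map_pow, map_one,
        FreeAlgebra.lift_ι_apply, v] <;> assumption
  refine ⟨RingQuot.liftAlgHom ℂ ⟨FreeAlgebra.lift ℂ v, w⟩, ?_, ?_, ?_, ?_, ?_, ?_⟩ <;>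
    simp only [uE, uF, uK, uKi, uH, uHi, gE, gF, gK, gKi, gH, gHi,
      RingQuot.liftAlgHom_mkAlgHom_apply, FreeAlgebra.lift_ι_apply, v]

/-- The universal property of `U_q(f_m(K))`. -/
theorem U2.exists_lift {A : Type*} [Ring A] [Algebra ℂ A] {q : ℂ} {m : ℕ}
    {E F K Ki : A} (hKKi : K * Ki = 1) (hKiK : Ki * K = 1)
    (hKE : K * E = q ^ 2 • (E * K)) (hKF : K * F = (q ^ 2)⁻¹ • (F * K))
    (hEF : E * F - F * E = (q - q⁻¹)⁻¹ • (K ^ m - Ki ^ m)) :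
    ∃ f : U2 q m →ₐ[ℂ] A,
      f (u2E q m) = E ∧ f (u2F q m) = F ∧ f (u2K q m) = K ∧ f (u2Ki q m) = Ki := by
  let v : Gen2 → A := fun x => Gen2.casesOn x E F K Ki
  have w : ∀ ⦃x y⦄, URel2 q m x y → FreeAlgebra.lift ℂ v x = FreeAlgebra.lift ℂ v y := by
    intro x y h
    cases h <;>
      simp only [g2E, g2F, g2K, g2Ki, map_mul, map_sub, map_smul, map_pow, map_one,
        FreeAlgebra.lift_ι_apply, v] <;> assumption
  refine ⟨RingQuot.liftAlgHom ℂ ⟨FreeAlgebra.lift ℂ v, w⟩, ?_, ?_, ?_, ?_⟩ <;>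
    simp only [u2E, u2F, u2K, u2Ki, g2E, g2F, g2K, g2Ki,
      RingQuot.liftAlgHom_mkAlgHom_apply, FreeAlgebra.lift_ι_apply, v]

/-- The algebra `U_q(f_m(K))` is generated by `E, F, K, K⁻¹`. -/
theorem U2.eq_top_of_mem {q : ℂ} {m : ℕ} {S : Subalgebra ℂ (U2 q m)}
    (hE : u2E q m ∈ S) (hF : u2F q m ∈ S) (hK : u2K q m ∈ S) (hKi : u2Ki q m ∈ S) :
    S = ⊤ := by
  refine eq_top_iff.2 fun y _ => ?_
  obtain ⟨x, rfl⟩ := RingQuot.mkAlgHom_surjective ℂ (URel2 q m) y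
  induction x using FreeAlgebra.induction with
  | grade0 c => rw [AlgHom.commutes]; exact S.algebraMap_mem c
  | grade1 x => cases x; exacts [hE, hF, hK, hKi]
  | mul a b ha hb => rw [map_mul]; exact S.mul_mem (ha trivial) (hb trivial)
  | add a b ha hb => rw [map_add]; exact S.add_mem (ha trivial) (hb trivial)

/-- If `k` commutes with `e` up to a nonzero scalar `c`, then `k⁻¹` commutes with `e`
up to `c⁻¹`. -/
theorem inv_mul_eq_inv_smul_mul_inv {A : Type*} [Ring A] [Algebra ℂ A] {k ki e : A} {c : ℂ}
    (hc : c ≠ 0) (h₁ : k * ki = 1) (h₂ : ki * k = 1) (h : k * e = c • (e * k)) :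
    ki * e = c⁻¹ • (e * ki) := by
  have key : e * ki = c • (ki * e) := by
    calc e * ki = ki * (k * e) * ki := by rw [← mul_assoc ki, h₂, one_mul]
      _ = c • (ki * e) := by
        rw [h, mul_smul_comm, smul_mul_assoc, mul_assoc, mul_assoc, h₁, mul_one]
  rw [key, inv_smul_smul₀ hc]

section Relations

variable (q : ℂ) (m : ℕ)

theorem u2K_mul_u2Ki : u2K q m * u2Ki q m = 1 := by
  simpa [u2K, u2Ki] using RingQuot.mkAlgHom_rel ℂ (URel2.KKi (q := q) (m := m))

theorem u2Ki_mul_u2K : u2Ki q m * u2K q m = 1 := by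
  simpa [u2K, u2Ki] using RingQuot.mkAlgHom_rel ℂ (URel2.KiK (q := q) (m := m))

theorem u2K_mul_u2E : u2K q m * u2E q m = q ^ 2 • (u2E q m * u2K q m) := by
  simpa [u2K, u2E] using RingQuot.mkAlgHom_rel ℂ (URel2.KE (q := q) (m := m))

theorem u2K_mul_u2F : u2K q m * u2F q m = (q ^ 2)⁻¹ • (u2F q m * u2K q m) := by
  simpa only [u2K, u2F, map_mul, map_smul] using
    RingQuot.mkAlgHom_rel ℂ (URel2.KF (q := q) (m := m))

theorem u2E_mul_u2F_sub : u2E q m * u2F q m - u2F q m * u2E q m =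
    (q - q⁻¹)⁻¹ • (u2K q m ^ m - u2Ki q m ^ m) := by
  simpa only [u2E, u2F, u2K, u2Ki, map_mul, map_sub, map_smul, map_pow] using
    RingQuot.mkAlgHom_rel ℂ (URel2.EF (q := q) (m := m))

variable (r : FA)

theorem uK_mul_uKi : uK q r * uKi q r = 1 := by
  simpa [uK, uKi] using RingQuot.mkAlgHom_rel ℂ (URel.KKi (q := q) (r := r))

theorem uKi_mul_uK : uKi q r * uK q r = 1 := by
  simpa [uK, uKi] using RingQuot.mkAlgHom_rel ℂ (URel.KiK (q := q) (r := r))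

theorem uH_mul_uHi : uH q r * uHi q r = 1 := by
  simpa [uH, uHi] using RingQuot.mkAlgHom_rel ℂ (URel.HHi (q := q) (r := r))

theorem uK_mul_uE : uK q r * uE q r = q ^ 2 • (uE q r * uK q r) := by
  simpa only [uK, uE, map_mul, map_smul] using
    RingQuot.mkAlgHom_rel ℂ (URel.KE (q := q) (r := r))

theorem uK_mul_uF : uK q r * uF q r = (q ^ 2)⁻¹ • (uF q r * uK q r) := by
  simpa only [uK, uF, map_mul, map_smul] using
    RingQuot.mkAlgHom_rel ℂ (URel.KF (q := q) (r := r))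

theorem uE_mul_uF_sub : uE q (fm q m) * uF q (fm q m) - uF q (fm q m) * uE q (fm q m) =
    (q - q⁻¹)⁻¹ • (uK q (fm q m) ^ m - uH q (fm q m) ^ m) := by
  have h := RingQuot.mkAlgHom_rel ℂ (URel.EF (q := q) (r := fm q m))
  conv_rhs at h => arg 2; rw [fm]
  simpa only [uE, uF, uK, uH, map_mul, map_sub, map_smul, map_pow] using h

end Relations

/-- An algebra homomorphism out of `U_q(f_m(K,H))` sending `KH` to `1` factors through
`U_q(f_m(K))`. -/
theorem Um.exists_factor {A : Type*} [Ring A] [Algebra ℂ A] {q : ℂ} {m : ℕ}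
    {π : Um q m →ₐ[ℂ] U2 q m}
    (hπ : π (uE q (fm q m)) = u2E q m ∧ π (uF q (fm q m)) = u2F q m ∧
      π (uK q (fm q m)) = u2K q m ∧ π (uKi q (fm q m)) = u2Ki q m ∧
      π (uH q (fm q m)) = u2Ki q m ∧ π (uHi q (fm q m)) = u2K q m)
    (g : Um q m →ₐ[ℂ] A) (hg : g (uK q (fm q m) * uH q (fm q m)) = 1) :
    ∃ ψ : U2 q m →ₐ[ℂ] A, ψ.comp π = g := by
  obtain ⟨hE, hF, hK, hKi, hH, hHi⟩ := hπ
  rw [map_mul] at hg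
  have hKKi := congrArg g (uK_mul_uKi q (fm q m))
  have hKiK := congrArg g (uKi_mul_uK q (fm q m))
  have hHHi := congrArg g (uH_mul_uHi q (fm q m))
  have hKE := congrArg g (uK_mul_uE q (fm q m))
  have hKF := congrArg g (uK_mul_uF q (fm q m))
  have hEF := congrArg g (uE_mul_uF_sub q m)
  simp only [map_mul, map_one, map_smul, map_sub, map_pow] at hKKi hKiK hHHi hKE hKF hEF
  have gH : g (uH q (fm q m)) = g (uKi q (fm q m)) := (left_inv_eq_right_inv hKiK hg).symm
  have gHi : g (uHi q (fm q m)) = g (uK q (fm q m)) := (left_inv_eq_right_inv hg hHHi).symm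
  rw [gH] at hEF
  obtain ⟨ψ, ψE, ψF, ψK, ψKi⟩ := U2.exists_lift hKKi hKiK hKE hKF hEF
  refine ⟨ψ, Uq.algHom_ext ?_ ?_ ?_ ?_ ?_ ?_⟩ <;>
    simp only [AlgHom.comp_apply, hE, hF, hK, hKi, hH, hHi, ψE, ψF, ψK, ψKi, gH, gHi]

/-- The assignment `E ↦ E, F ↦ F, K ↦ K, K⁻¹ ↦ K⁻¹, H ↦ K⁻¹, H⁻¹ ↦ K`
extends to a unique ℂ-algebra homomorphism `π : U_q(f_m(K,H)) → U_q(f_m(K))`; this `π`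
is surjective and its kernel is the two-sided ideal generated by `KH - 1`. -/
theorem stmt7 (q : ℂ) (hq0 : q ≠ 0) (hq : ∀ n : ℕ, 0 < n → q ^ n ≠ 1)
    (m : ℕ) (hm : 1 ≤ m) :
    (∃! π : Um q m →ₐ[ℂ] U2 q m,
      π (uE q (fm q m)) = u2E q m ∧ π (uF q (fm q m)) = u2F q m ∧
      π (uK q (fm q m)) = u2K q m ∧ π (uKi q (fm q m)) = u2Ki q m ∧
      π (uH q (fm q m)) = u2Ki q m ∧ π (uHi q (fm q m)) = u2K q m) ∧
    (∀ π : Um q m →ₐ[ℂ] U2 q m,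
      (π (uE q (fm q m)) = u2E q m ∧ π (uF q (fm q m)) = u2F q m ∧
       π (uK q (fm q m)) = u2K q m ∧ π (uKi q (fm q m)) = u2Ki q m ∧
       π (uH q (fm q m)) = u2Ki q m ∧ π (uHi q (fm q m)) = u2K q m) →
      Function.Surjective π ∧
      ∀ x : Um q m, π x = 0 ↔
        x ∈ TwoSidedIdeal.span {uK q (fm q m) * uH q (fm q m) - 1}) := by
  have hq2 : q ^ 2 ≠ 0 := pow_ne_zero 2 hq0
  have hKKi := u2K_mul_u2Ki q m
  have hKiK := u2Ki_mul_u2K q m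
  have hKE := u2K_mul_u2E q m
  have hKF := u2K_mul_u2F q m
  refine ⟨?_, fun π hπ => ⟨?_, fun x => ⟨fun hx => ?_, fun hx => ?_⟩⟩⟩
  · have hKiF := inv_mul_eq_inv_smul_mul_inv (inv_ne_zero hq2) hKKi hKiK hKF
    rw [inv_inv] at hKiF
    obtain ⟨π, hπ⟩ := Um.exists_lift hKKi hKiK hKiK hKKi (hKKi.trans hKiK.symm) hKE hKF
      (inv_mul_eq_inv_smul_mul_inv hq2 hKKi hKiK hKE) hKiF (u2E_mul_u2F_sub q m)
    refine ⟨π, hπ, ?_⟩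
    obtain ⟨hE, hF, hK, hKi, hH, hHi⟩ := hπ
    rintro π' ⟨hE', hF', hK', hKi', hH', hHi'⟩
    exact Uq.algHom_ext (hE'.trans hE.symm) (hF'.trans hF.symm) (hK'.trans hK.symm)
      (hKi'.trans hKi.symm) (hH'.trans hH.symm) (hHi'.trans hHi.symm)
  · obtain ⟨hE, hF, hK, hKi, -, -⟩ := hπ
    exact AlgHom.range_eq_top π |>.1 <|
      U2.eq_top_of_mem ⟨_, hE⟩ ⟨_, hF⟩ ⟨_, hK⟩ ⟨_, hKi⟩
  · set I := TwoSidedIdeal.span {uK q (fm q m) * uH q (fm q m) - 1}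
    have hI : uK q (fm q m) * uH q (fm q m) - 1 ∈ I :=
      TwoSidedIdeal.subset_span (Set.mem_singleton _)
    obtain ⟨ψ, hψ⟩ := Um.exists_factor hπ (I.ringCon.mkₐ ℂ)
      ((RingCon.eq I.ringCon).2 ((I.rel_iff _ _).2 hI))
    have hx' : I.ringCon.mkₐ ℂ x = 0 := by
      rw [← hψ, AlgHom.comp_apply, hx, map_zero]
    exact (I.mem_iff x).2 ((RingCon.eq I.ringCon).1 hx')
  · have hle : TwoSidedIdeal.span {uK q (fm q m) * uH q (fm q m) - 1} ≤
        TwoSidedIdeal.ker π := by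
      rw [TwoSidedIdeal.span_le, Set.singleton_subset_iff, SetLike.mem_coe,
        TwoSidedIdeal.mem_ker, map_sub, map_mul, map_one, hπ.2.2.1, hπ.2.2.2.2.1, hKKi, sub_self]
    exact (TwoSidedIdeal.mem_ker π).1 (hle hx)
end
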